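/- Let X and Y be Banach spaces, let E = ℓ_p for some p ∈ [1,∞) or E = c₀, let C' > C ≥ 1, and let S, T : X → Y be bounded operators, where S is strictly singular and T C-fixes a copy of E. Then S + T C'-fixes a copy of E. -/

import Mathlib

open scoped ENNReal ZeroAtInfty

/-- `T` `C`-fixes a copy of `E`. -/
def CFixesCopy {𝕜 : Type*} [RCLike 𝕜] (E : Type*) [NormedAddCommGroup E] [NormedSpace 𝕜 E]
    {X Y : Type*} [NormedAddCommGroup X] [NormedSpace 𝕜 X]
    [NormedAddCommGroup Y] [NormedSpace 𝕜 Y]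
    (T : X →L[𝕜] Y) (C : ℝ) : Prop :=
  ∃ R : E →L[𝕜] X, ‖R‖ ≤ C ∧ ∀ e : E, (1 / C) * ‖e‖ ≤ ‖T (R e)‖

/-- `S` is strictly singular: not bounded below on any closed infinite-dimensional
subspace of its domain. -/
def StrictlySingular {𝕜 : Type*} [RCLike 𝕜] {X Y : Type*}
    [NormedAddCommGroup X] [NormedSpace 𝕜 X]
    [NormedAddCommGroup Y] [NormedSpace 𝕜 Y] (S : X →L[𝕜] Y) : Prop :=
  ∀ W : Submodule 𝕜 X, IsClosed (W : Set X) → ¬ FiniteDimensional 𝕜 W →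
    ¬ ∃ c : ℝ, 0 < c ∧ ∀ x ∈ W, c * ‖x‖ ≤ ‖S x‖

theorem aux_small {𝕜 : Type*} [RCLike 𝕜] {E X Y : Type*} [NormedAddCommGroup E] [NormedSpace 𝕜 E]
    [NormedAddCommGroup X] [NormedSpace 𝕜 X] [NormedAddCommGroup Y] [NormedSpace 𝕜 Y]
    (δ : ℕ → E) (φ : ℕ → E →ₗ[𝕜] 𝕜) (hφδ : ∀ i j, φ i (δ j) = if i = j then 1 else 0)
    (S : X →L[𝕜] Y) (hS : StrictlySingular (𝕜 := 𝕜) S) (R : E →L[𝕜] X)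
    (hR : Function.Injective R) (n : ℕ) (ε : ℝ) (hε : 0 < ε) :
    ∃ x : E, ∃ m : ℕ, ‖x‖ = 1 ∧ n < m ∧ (∀ j, φ j x ≠ 0 → n ≤ j ∧ j < m) ∧ ‖S (R x)‖ ≤ ε := by
  by_contra hcon
  push Not at hcon
  let V : Submodule 𝕜 E :=
    { carrier := {x | ∃ m, n < m ∧ ∀ j, (j < n ∨ m ≤ j) → φ j x = 0}
      zero_mem' := ⟨n + 1, by omega, by simp⟩
      add_mem' := by
        rintro a b ⟨m, hm, h⟩ ⟨m', hm', h'⟩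
        refine ⟨max m m', by omega, fun j hj => ?_⟩
        rw [map_add, h j (by omega), h' j (by omega), add_zero]
      smul_mem' := by
        rintro c a ⟨m, hm, h⟩
        refine ⟨m, hm, fun j hj => ?_⟩
        rw [map_smul, h j hj, smul_zero] }
  have hV : ∀ x ∈ V, ε * ‖x‖ ≤ ‖S (R x)‖ := by
    rintro x ⟨m, hm, h⟩
    by_cases hx : x = 0
    · simp [hx]
    have hx' : 0 < ‖x‖ := norm_pos_iff.2 hx
    have := hcon (((‖x‖⁻¹ : ℝ) : 𝕜) • x) m (by
      rw [norm_smul, RCLike.norm_ofReal, abs_of_pos (by positivity)]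
      exact inv_mul_cancel₀ hx'.ne') hm (by
      intro j hj
      by_contra hh
      apply hj
      rw [map_smul, h j (by omega), smul_zero])
    rw [map_smul, map_smul, norm_smul, RCLike.norm_ofReal, abs_of_pos (by positivity)] at this
    rw [inv_mul_eq_div, lt_div_iff₀ hx'] at this
    exact this.le
  let W := (V.map (R : E →ₗ[𝕜] X)).topologicalClosure
  have hδV : ∀ j, δ (n + j) ∈ V := by
    intro j
    refine ⟨n + j + 1, by omega, fun i hi => ?_⟩
    rw [hφδ, if_neg (by omega)]
  have hli : LinearIndependent 𝕜 (fun j => δ (n + j)) := by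
    rw [linearIndependent_iff']
    intro s g hg i hi
    have := congrArg (φ (n + i)) hg
    simpa [hφδ, hi] using this
  have hli2 : LinearIndependent 𝕜 (fun j => R (δ (n + j))) :=
    hli.map' (R : E →ₗ[𝕜] X) (LinearMap.ker_eq_bot.2 hR)
  have hmem : ∀ j, R (δ (n + j)) ∈ W := fun j =>
    Submodule.le_topologicalClosure _ ⟨_, hδV j, rfl⟩
  refine hS W (Submodule.isClosed_topologicalClosure _) ?_ ⟨ε / (‖R‖ + 1), by positivity, ?_⟩
  · intro hfin
    have hli3 : LinearIndependent 𝕜 (fun j => (⟨R (δ (n + j)), hmem j⟩ : W)) :=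
      LinearIndependent.of_comp W.subtype hli2
    have := hli3.finite_of_isNoetherian
    exact not_finite ℕ
  · intro x hx
    have hcl : IsClosed {x : X | ε / (‖R‖ + 1) * ‖x‖ ≤ ‖S x‖} :=
      isClosed_le (by fun_prop) (by fun_prop)
    refine closure_minimal ?_ hcl hx
    rintro _ ⟨e, he, rfl⟩
    have h1 := hV e he
    have h2 : ‖R e‖ ≤ (‖R‖ + 1) * ‖e‖ := (R.le_opNorm e).trans (by gcongr; linarith)
    refine le_trans ?_ h1
    change ε / (‖R‖ + 1) * ‖R e‖ ≤ _
    calc ε / (‖R‖ + 1) * ‖R e‖ ≤ ε / (‖R‖ + 1) * ((‖R‖ + 1) * ‖e‖) := by gcongr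
      _ = ε * ‖e‖ := by field_simp

theorem aux_main {𝕜 : Type*} [RCLike 𝕜] {E X Y : Type*} [NormedAddCommGroup E] [NormedSpace 𝕜 E]
    [NormedAddCommGroup X] [NormedSpace 𝕜 X] [NormedAddCommGroup Y] [NormedSpace 𝕜 Y]
    (δ : ℕ → E) (φ : ℕ → E →ₗ[𝕜] 𝕜) (hφδ : ∀ i j, φ i (δ j) = if i = j then 1 else 0)
    (hφ : ∀ i e, ‖φ i e‖ ≤ ‖e‖) (hsum : ∀ e, HasSum (fun k => φ k e • δ k) e)
    (hU : ∀ (κ : ℕ → ℕ) (x : ℕ → E), Filter.Tendsto κ Filter.atTop Filter.atTop →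
      (∀ k, ‖x k‖ = 1) → (∀ k n, φ n (x k) ≠ 0 → κ n = k) →
      ∃ U : E →ₗᵢ[𝕜] E, ∀ k, U (δ k) = x k)
    {C C' : ℝ} (hC : 1 ≤ C) (hCC' : C < C')
    (S T : X →L[𝕜] Y) (hS : StrictlySingular (𝕜 := 𝕜) S)
    (hT : CFixesCopy (𝕜 := 𝕜) E T C) : CFixesCopy (𝕜 := 𝕜) E (S + T) C' := by
  obtain ⟨R, hR, hb⟩ := hT
  have hC0 : 0 < C := by linarith
  have hC0' : 0 < C' := by linarith
  have hRinj : Function.Injective R := by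
    rw [injective_iff_map_eq_zero]
    intro e he
    have := hb e
    rw [he, map_zero, norm_zero] at this
    have h3 : 0 < 1 / C := by positivity
    exact norm_le_zero_iff.1 (by nlinarith [norm_nonneg e])
  have hη : 0 < 1 / C - 1 / C' := sub_pos.2 (one_div_lt_one_div_of_lt hC0 hCC')
  set η := 1 / C - 1 / C' with hηdef
  have key := fun n (k : ℕ) => aux_small δ φ hφδ S hS R hRinj n (η / 2 / 2 ^ k) (by positivity)
  choose x m hx1 hm hx2 hx3 using key
  obtain ⟨N, hNs⟩ : ∃ N : ℕ → ℕ, ∀ k, N (k + 1) = m (N k) k :=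
    ⟨fun k => Nat.rec 0 (fun k a => m a k) k, fun k => rfl⟩
  have hNmono : StrictMono N := strictMono_nat_of_lt_succ fun k => by rw [hNs]; exact hm _ _
  let κ : ℕ → ℕ := fun n => Nat.findGreatest (fun k => N k ≤ n) n
  have hκ : ∀ k n, N k ≤ n → n < N (k + 1) → κ n = k := by
    intro k n h1 h2
    have hk : k ≤ n := (hNmono.id_le k).trans h1
    apply le_antisymm
    · have h4 : N (κ n) ≤ n := Nat.findGreatest_spec (P := fun k => N k ≤ n) hk h1
      have : N (κ n) < N (k + 1) := by omega
      have := hNmono.lt_iff_lt.1 this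
      omega
    · exact Nat.le_findGreatest (P := fun k => N k ≤ n) hk h1
  have hκt : Filter.Tendsto κ Filter.atTop Filter.atTop := by
    rw [Filter.tendsto_atTop]
    intro b
    filter_upwards [Filter.eventually_ge_atTop (N b)] with n hn
    exact Nat.le_findGreatest (P := fun k => N k ≤ n) ((hNmono.id_le b).trans hn) hn
  obtain ⟨U, hUδ⟩ := hU κ (fun k => x (N k) k) hκt (fun k => hx1 _ _) (fun k n h => by
    obtain ⟨h1, h2⟩ := hx2 _ _ _ h
    exact hκ k n h1 (by rw [hNs]; exact h2))
  refine ⟨R.comp U.toContinuousLinearMap, ?_, fun e => ?_⟩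
  · refine ContinuousLinearMap.opNorm_le_bound _ hC0'.le fun e => ?_
    have := R.le_opNorm (U e)
    rw [U.norm_map] at this
    refine this.trans ?_
    gcongr
    linarith
  · have h1 := (hsum e).mapL ((S.comp R).comp U.toContinuousLinearMap)
    have h2 : ‖S (R (U e))‖ ≤ η * ‖e‖ := by
      have h4 : HasSum (fun k : ℕ => (η * ‖e‖) / 2 / 2 ^ k) (η * ‖e‖) := hasSum_geometric_two' _
      have h5 := tsum_of_norm_bounded h4 (f := fun k => ((S.comp R).comp U.toContinuousLinearMap) (φ k e • δ k)) (by
        intro k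
        rw [map_smul, norm_smul]
        have h6 : ‖((S.comp R).comp U.toContinuousLinearMap) (δ k)‖ ≤ η / 2 / 2 ^ k := by
          have := hx3 (N k) k
          rw [← hUδ k] at this
          exact this
        calc _ ≤ ‖e‖ * (η / 2 / 2 ^ k) := by gcongr; exact hφ k e
          _ = _ := by ring)
      rw [h1.tsum_eq] at h5
      exact h5
    have h7 := hb (U e)
    rw [U.norm_map] at h7
    have h8 : ‖T (R (U e))‖ ≤ ‖(S + T) (R (U e))‖ + ‖S (R (U e))‖ := by
      have : T (R (U e)) = (S + T) (R (U e)) - S (R (U e)) := by simp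
      rw [this]; exact norm_sub_le _ _
    change 1 / C' * ‖e‖ ≤ ‖(S + T) (R (U e))‖
    have : η * ‖e‖ = 1 / C * ‖e‖ - 1 / C' * ‖e‖ := by rw [hηdef]; ring
    linarith

theorem aux_lp {𝕜 : Type*} [RCLike 𝕜] (p : ℝ≥0∞) [Fact (1 ≤ p)] (hp : p ≠ ∞)
    (κ : ℕ → ℕ) (x : ℕ → lp (fun _ : ℕ => 𝕜) p)
    (hx : ∀ k, ‖x k‖ = 1) (hκ : ∀ k n, x k n ≠ 0 → κ n = k) :
    ∃ U : lp (fun _ : ℕ => 𝕜) p →ₗᵢ[𝕜] lp (fun _ : ℕ => 𝕜) p,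
      ∀ k, U (lp.single p k (1 : 𝕜)) = x k := by
  have hp0 : p ≠ 0 := (zero_lt_one.trans_le (Fact.out : 1 ≤ p)).ne'
  have hq : 0 < p.toReal := ENNReal.toReal_pos hp0 hp
  have key : ∀ e : lp (fun _ : ℕ => 𝕜) p,
      HasSum (fun n => ‖e (κ n) * x (κ n) n‖ ^ p.toReal) (‖e‖ ^ p.toReal) := by
    intro e
    have hin : ∀ k, HasSum (fun n : {n // κ n = k} => ‖e (κ n) * x (κ n) n‖ ^ p.toReal)
        (‖e k‖ ^ p.toReal) := by
      intro k
      have h1 := lp.hasSum_norm hq (x k)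
      rw [hx, Real.one_rpow] at h1
      have h2 := (hasSum_subtype_iff_of_support_subset (s := {n | κ n = k}) (by
        intro n hn
        apply hκ k n
        intro h0
        apply hn
        simp [h0, hq.ne'])).2 h1
      have h3 := h2.mul_left (‖e k‖ ^ p.toReal)
      rw [mul_one] at h3
      refine Eq.mp (congrArg (fun f => HasSum f _) (funext ?_)) h3
      rintro ⟨n, hn⟩
      have hn : κ n = k := hn
      subst hn
      simp [Real.mul_rpow]
    rw [← (Equiv.sigmaFiberEquiv κ).hasSum_iff]
    have hout := lp.hasSum_norm hq e
    have hsm : Summable ((fun n => ‖e (κ n) * x (κ n) n‖ ^ p.toReal) ∘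
        (Equiv.sigmaFiberEquiv κ)) := by
      rw [summable_sigma_of_nonneg (fun a => by simp only [Function.comp]; positivity)]
      refine ⟨fun k => (hin k).summable, ?_⟩
      refine (summable_congr fun k => ?_).2 hout.summable
      exact (hin k).tsum_eq
    have h5 := hsm.hasSum.sigma (fun k => hin k)
    rw [hout.unique h5]
    exact hsm.hasSum
  have mem : ∀ e : lp (fun _ : ℕ => 𝕜) p, Memℓp (fun n => e (κ n) * x (κ n) n) p :=
    fun e => (memℓp_gen_iff hq).2 (key e).summable
  let U0 : lp (fun _ : ℕ => 𝕜) p →ₗ[𝕜] lp (fun _ : ℕ => 𝕜) p :=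
    { toFun := fun e => ⟨fun n => e (κ n) * x (κ n) n, mem e⟩
      map_add' := fun a b => by
        ext n
        change (a (κ n) + b (κ n)) * x (κ n) n = a (κ n) * x (κ n) n + b (κ n) * x (κ n) n
        ring
      map_smul' := fun c a => by
        ext n
        change (c * a (κ n)) * x (κ n) n = c * (a (κ n) * x (κ n) n)
        ring }
  refine ⟨⟨U0, fun e => ?_⟩, fun k => ?_⟩
  · have h1 := lp.hasSum_norm hq (U0 e)
    have h2 := h1.unique (key e)
    exact (Real.rpow_left_inj (norm_nonneg _) (norm_nonneg _) hq.ne').1 h2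
  · ext n
    change (lp.single (E := fun _ : ℕ => 𝕜) p k (1 : 𝕜)) (κ n) * x (κ n) n = x k n
    by_cases h : κ n = k
    · subst h
      simp
    · have : x k n = 0 := by
        by_contra h'
        exact h (hκ k n h')
      rw [this, lp.single_apply_ne _ _ _ h, zero_mul]

theorem c0_norm_le {𝕜 : Type*} [RCLike 𝕜] (f : C₀(ℕ, 𝕜)) {c : ℝ} (hc : 0 ≤ c) :
    ‖f‖ ≤ c ↔ ∀ n, ‖f n‖ ≤ c := by
  rw [← ZeroAtInftyContinuousMap.norm_toBCF_eq_norm, BoundedContinuousFunction.norm_le hc]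
  rfl

theorem c0_coe_le {𝕜 : Type*} [RCLike 𝕜] (f : C₀(ℕ, 𝕜)) (n : ℕ) : ‖f n‖ ≤ ‖f‖ :=
  (c0_norm_le f (norm_nonneg _)).1 le_rfl n

theorem c0_tendsto {𝕜 : Type*} [RCLike 𝕜] (f : C₀(ℕ, 𝕜)) :
    Filter.Tendsto f Filter.atTop (nhds 0) := by
  have := f.zero_at_infty'
  rwa [Filter.cocompact_eq_cofinite, Nat.cofinite_eq_atTop] at this

/-- build an element of `c₀` -/
def c0mk {𝕜 : Type*} [RCLike 𝕜] (f : ℕ → 𝕜) (h : Filter.Tendsto f Filter.atTop (nhds 0)) :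
    C₀(ℕ, 𝕜) where
  toFun := f
  continuous_toFun := continuous_of_discreteTopology
  zero_at_infty' := by
    rwa [Filter.cocompact_eq_cofinite, Nat.cofinite_eq_atTop]

theorem c0single_tendsto {𝕜 : Type*} [RCLike 𝕜] (k : ℕ) :
    Filter.Tendsto (fun n => if n = k then (1 : 𝕜) else 0) Filter.atTop (nhds 0) := by
  refine tendsto_const_nhds.congr' ?_
  filter_upwards [Filter.eventually_gt_atTop k] with n hn
  rw [if_neg (by omega)]

/-- unit vectors -/
def c0single (𝕜 : Type*) [RCLike 𝕜] (k : ℕ) : C₀(ℕ, 𝕜) := c0mk _ (c0single_tendsto k)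

theorem c0single_apply {𝕜 : Type*} [RCLike 𝕜] (k n : ℕ) :
    c0single 𝕜 k n = if n = k then 1 else 0 := rfl

/-- evaluation -/
def c0eval (𝕜 : Type*) [RCLike 𝕜] (n : ℕ) : C₀(ℕ, 𝕜) →ₗ[𝕜] 𝕜 where
  toFun f := f n
  map_add' _ _ := rfl
  map_smul' _ _ := rfl

theorem c0_hasSum {𝕜 : Type*} [RCLike 𝕜] (e : C₀(ℕ, 𝕜)) :
    HasSum (fun k => e k • c0single 𝕜 k) e := by
  have happ : ∀ (s : Finset ℕ) (n : ℕ),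
      (∑ k ∈ s, e k • c0single 𝕜 k) n = if n ∈ s then e n else 0 := by
    intro s n
    change c0eval 𝕜 n (∑ k ∈ s, e k • c0single 𝕜 k) = _
    rw [map_sum]
    have : ∀ k, c0eval 𝕜 n (e k • c0single 𝕜 k) = if n = k then e k else 0 := by
      intro k
      rw [map_smul]
      change e k • c0single 𝕜 k n = _
      rw [c0single_apply]
      simp
    simp [this]
  rw [HasSum, SummationFilter.unconditional_filter, Metric.tendsto_atTop]
  intro ε hε
  have h := Metric.tendsto_atTop.1 (c0_tendsto e) (ε / 2) (by positivity)
  obtain ⟨M, hM⟩ := h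
  refine ⟨Finset.range M, fun s hs => ?_⟩
  rw [dist_eq_norm]
  refine lt_of_le_of_lt ((c0_norm_le _ (c := ε / 2) (by positivity)).2 fun n => ?_) (by linarith)
  change ‖(∑ k ∈ s, e k • c0single 𝕜 k) n - e n‖ ≤ _
  rw [happ]
  split_ifs with hn
  · simp; positivity
  · have : M ≤ n := by
      by_contra h'
      exact hn (hs (by simp; omega))
    have := hM n this
    rw [dist_zero_right] at this
    simpa using this.le

theorem aux_c0 {𝕜 : Type*} [RCLike 𝕜] (κ : ℕ → ℕ) (x : ℕ → C₀(ℕ, 𝕜))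
    (hκt : Filter.Tendsto κ Filter.atTop Filter.atTop)
    (hx : ∀ k, ‖x k‖ = 1) (hκ : ∀ k n, x k n ≠ 0 → κ n = k) :
    ∃ U : C₀(ℕ, 𝕜) →ₗᵢ[𝕜] C₀(ℕ, 𝕜), ∀ k, U (c0single 𝕜 k) = x k := by
  have hle : ∀ k n, ‖x k n‖ ≤ 1 := fun k n => (c0_coe_le (x k) n).trans (hx k).le
  have hle2 : ∀ (e : C₀(ℕ, 𝕜)) n, ‖e (κ n) * x (κ n) n‖ ≤ ‖e (κ n)‖ := fun e n => by
    rw [norm_mul]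
    exact mul_le_of_le_one_right (norm_nonneg _) (hle _ _)
  have ht : ∀ e : C₀(ℕ, 𝕜),
      Filter.Tendsto (fun n => e (κ n) * x (κ n) n) Filter.atTop (nhds 0) := by
    intro e
    refine squeeze_zero_norm (hle2 e) ?_
    simpa using ((c0_tendsto e).comp hκt).norm
  let U0 : C₀(ℕ, 𝕜) →ₗ[𝕜] C₀(ℕ, 𝕜) :=
    { toFun := fun e => c0mk _ (ht e)
      map_add' := fun a b => by
        ext n
        change (a (κ n) + b (κ n)) * x (κ n) n = a (κ n) * x (κ n) n + b (κ n) * x (κ n) n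
        ring
      map_smul' := fun c a => by
        ext n
        change (c * a (κ n)) * x (κ n) n = c * (a (κ n) * x (κ n) n)
        ring }
  have hU0 : ∀ e n, U0 e n = e (κ n) * x (κ n) n := fun _ _ => rfl
  refine ⟨⟨U0, fun e => le_antisymm ?_ ?_⟩, fun k => ?_⟩
  · rw [c0_norm_le _ (norm_nonneg _)]
    intro n
    rw [hU0]
    exact (hle2 e n).trans (c0_coe_le _ _)
  · rw [c0_norm_le _ (norm_nonneg _)]
    intro k
    have h : ‖e k • x k‖ ≤ ‖U0 e‖ := by
      rw [c0_norm_le _ (norm_nonneg _)]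
      intro n
      change ‖e k * x k n‖ ≤ _
      by_cases h : x k n = 0
      · simp [h]
      · have h1 := c0_coe_le (U0 e) n
        rwa [hU0, hκ k n h] at h1
    rwa [norm_smul, hx, mul_one] at h
  · ext n
    change c0single 𝕜 k (κ n) * x (κ n) n = x k n
    rw [c0single_apply]
    by_cases h : κ n = k
    · simp [h]
    · have : x k n = 0 := by
        by_contra h'
        exact h (hκ k n h')
      rw [this, if_neg h, zero_mul]

/-- Let `E = ℓ_p` (`1 ≤ p < ∞`) or `E = c₀`, let `C' > C ≥ 1`, and let
`S, T : X → Y` be bounded operators where `S` is strictly singular and `T` `C`-fixes a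
copy of `E`. Then `S + T` `C'`-fixes a copy of `E`. -/
theorem strictlySingular_perturbation {𝕜 : Type*} [RCLike 𝕜]
    {X Y : Type*} [NormedAddCommGroup X] [NormedSpace 𝕜 X] [CompleteSpace X]
    [NormedAddCommGroup Y] [NormedSpace 𝕜 Y] [CompleteSpace Y]
    {C C' : ℝ} (hC : 1 ≤ C) (hCC' : C < C')
    (S T : X →L[𝕜] Y) (hS : StrictlySingular (𝕜 := 𝕜) S) :
    (∀ (p : ℝ≥0∞) (_ : Fact (1 ≤ p)), p ≠ ∞ →
      CFixesCopy (𝕜 := 𝕜) (lp (fun _ : ℕ => 𝕜) p) T C →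
        CFixesCopy (𝕜 := 𝕜) (lp (fun _ : ℕ => 𝕜) p) (S + T) C') ∧
    (CFixesCopy (𝕜 := 𝕜) C₀(ℕ, 𝕜) T C → CFixesCopy (𝕜 := 𝕜) C₀(ℕ, 𝕜) (S + T) C') := by
  refine ⟨fun p hp1 hp hT => ?_, fun hT => ?_⟩
  · have hp0 : p ≠ 0 := (zero_lt_one.trans_le hp1.out).ne'
    refine aux_main (fun k => lp.single p k (1 : 𝕜))
      (fun n => { toFun := fun f => f n, map_add' := fun _ _ => rfl, map_smul' := fun _ _ => rfl })
      ?_ ?_ ?_ ?_ hC hCC' S T hS hT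
    · intro i j
      change (lp.single (E := fun _ : ℕ => 𝕜) p j (1 : 𝕜)) i = _
      by_cases h : i = j
      · subst h; simp
      · rw [lp.single_apply_ne _ _ _ h, if_neg h]
    · intro i e
      exact lp.norm_apply_le_norm hp0 e i
    · intro e
      have := lp.hasSum_single hp e
      convert this using 2 with k
      change e k • lp.single (E := fun _ : ℕ => 𝕜) p k (1 : 𝕜) = _
      rw [← lp.single_smul]
      simp
    · intro κ x _ hx hκ
      exact aux_lp p hp κ x hx hκ
  · refine aux_main (c0single 𝕜) (c0eval 𝕜) (fun i j => c0single_apply j i)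
      (fun i e => c0_coe_le e i) (fun e => c0_hasSum e) ?_ hC hCC' S T hS hT
    intro κ x hκt hx hκ
    exact aux_c0 κ x hκt hx hκ
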